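/- arXiv:2506.14732 — 2 statements merged into one kernel-verified Lean document; each statement's English description precedes it below -/
import Mathlib

section
/- Let K be a number field with [K : ℚ] = 3. Then K is a pure cubic field — that is, there exists α ∈ K with K = ℚ(α) and α³ ∈ ℚ — if and only if there exists a positive integer f such that the discriminant of K equals −3·f². -/
/-- The discriminant of the power basis of a root of `X ^ 3 + p * X + r`. -/
theorem discr_powerBasis_depressed_cubic {F K : Type*} [Field F] [Field K] [Algebra F K]
    (b : Module.Basis (Fin 3) F K) (β : K) (p r : F) (hb : ∀ i, b i = β ^ (i : ℕ))
    (h : β ^ 3 + algebraMap F K p * β + algebraMap F K r = 0) :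
    Algebra.discr F b = -4 * p ^ 3 - 27 * r ^ 2 := by
  have hM : Algebra.leftMulMatrix b β = !![0, 0, -r; 1, 0, -p; 0, 1, 0] := by
    have h0 : β * b 0 = b 1 := by simp [hb]
    have h1 : β * b 1 = b 2 := by simp [hb, pow_two]
    have h2 : β * b 2 = (-r) • b 0 + (-p) • b 1 := by
      simp only [hb, Algebra.smul_def, map_neg]
      simp
      linear_combination h
    ext i j
    rw [Algebra.leftMulMatrix_eq_repr_mul]
    fin_cases j <;>
      simp only [Fin.zero_eta, Fin.mk_one, Fin.reduceFinMk, h0, h1, h2, map_add, map_smul,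
        Module.Basis.repr_self] <;>
      fin_cases i <;> simp
  have htr (i j : Fin 3) : Algebra.traceMatrix F b i j =
      (!![0, 0, -r; 1, 0, -p; 0, 1, 0] ^ ((i : ℕ) + j) : Matrix (Fin 3) (Fin 3) F).trace := by
    rw [Algebra.traceMatrix_apply, Algebra.traceForm_apply, hb, hb, ← pow_add,
      Algebra.trace_eq_matrix_trace b, map_pow, hM]
  rw [Algebra.discr_def, Matrix.det_fin_three]
  simp only [htr]
  simp [pow_succ, Matrix.trace_fin_three, Matrix.one_fin_three]
  ring

theorem exists_discr_eq_sq_mul_discr {ι F K : Type*} [Fintype ι] [DecidableEq ι] [Field F] [Field K]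
    [Algebra F K] (b c : Module.Basis ι F K) :
    ∃ s : F, s ≠ 0 ∧ Algebra.discr F b = s ^ 2 * Algebra.discr F c := by
  refine ⟨(c.toMatrix b).det, (c.isUnit_det b).ne_zero, ?_⟩
  rw [← Algebra.discr_of_matrix_vecMul, c.toMatrix_map_vecMul b]

theorem exists_discr_eq_sq_mul_numberField_discr {ι K : Type*} [Fintype ι] [DecidableEq ι] [Field K]
    [NumberField K] (b : Module.Basis ι ℚ K) :
    ∃ s : ℚ, s ≠ 0 ∧ Algebra.discr ℚ b = s ^ 2 * NumberField.discr K := by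
  let c := NumberField.integralBasis K
  obtain ⟨s, hs, h⟩ := exists_discr_eq_sq_mul_discr b (c.reindex (c.indexEquiv b))
  refine ⟨s, hs, ?_⟩
  rw [h, Module.Basis.coe_reindex, Algebra.discr_reindex, NumberField.coe_discr]

theorem adjoin_singleton_eq_top_of_notMem_range {F K : Type*} [Field F] [Field K] [Algebra F K]
    (hdeg : (Module.finrank F K).Prime) {β : K} (hβ : β ∉ Set.range (algebraMap F K)) :
    IntermediateField.adjoin F {β} = ⊤ := by
  have := IntermediateField.isSimpleOrder_of_finrank_prime F K hdeg
  refine (eq_bot_or_eq_top _).resolve_left fun h => hβ ?_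
  rw [← IntermediateField.mem_bot, ← h]
  exact IntermediateField.mem_adjoin_simple_self F β

theorem notMem_range_of_adjoin_singleton_eq_top {F K : Type*} [Field F] [Field K] [Algebra F K]
    (hdeg : Module.finrank F K ≠ 1) {β : K} (hβ : IntermediateField.adjoin F {β} = ⊤) :
    β ∉ Set.range (algebraMap F K) := by
  intro h
  rw [← IntermediateField.mem_bot, ← IntermediateField.adjoin_simple_eq_bot_iff, hβ] at h
  exact hdeg (IntermediateField.bot_eq_top_iff_finrank_eq_one.mp h.symm)

theorem exists_basis_pow {F K : Type*} [Field F] [Field K] [Algebra F K] [FiniteDimensional F K]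
    {n : ℕ} (hdeg : Module.finrank F K = n) {β : K} (hβ : IntermediateField.adjoin F {β} = ⊤) :
    ∃ b : Module.Basis (Fin n) F K, ∀ i, b i = β ^ (i : ℕ) := by
  have hn : (minpoly F β).natDegree = n := by
    rw [← IntermediateField.adjoin.finrank (Algebra.IsIntegral.isIntegral β), hβ,
      IntermediateField.finrank_top', hdeg]
  subst hn
  have : Nonempty (Fin (minpoly F β).natDegree) :=
    ⟨⟨0, minpoly.natDegree_pos (Algebra.IsIntegral.isIntegral β)⟩⟩
  exact ⟨basisOfLinearIndependentOfCardEqFinrank (linearIndependent_pow β) (by simp [hdeg]),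
    fun i => by simp⟩

/-- A cubic extension of characteristic zero is generated by a root of `X ^ 3 + p * X + r`. -/
theorem exists_depressed_cubic_generator {F K : Type*} [Field F] [CharZero F] [Field K]
    [Algebra F K] (hdeg : Module.finrank F K = 3) :
    ∃ β : K, IntermediateField.adjoin F {β} = ⊤ ∧
      ∃ p r : F, β ^ 3 + algebraMap F K p * β + algebraMap F K r = 0 := by
  have : FiniteDimensional F K := Module.finite_of_finrank_pos (by omega)
  obtain ⟨β, hβ⟩ := Field.exists_primitive_element F K
  obtain ⟨b, hb⟩ := exists_basis_pow hdeg hβ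
  have hcube := b.sum_repr (β ^ 3)
  simp only [Fin.sum_univ_three, hb, Algebra.smul_def] at hcube
  set x := b.repr (β ^ 3) 0
  set y := b.repr (β ^ 3) 1
  set z := b.repr (β ^ 3) 2
  refine ⟨β - algebraMap F K (z / 3),
    adjoin_singleton_eq_top_of_notMem_range (hdeg ▸ Nat.prime_three) ?_,
    -y - z ^ 2 / 3, -x - y * z / 3 - 2 * z ^ 3 / 27, ?_⟩
  · rintro ⟨t, ht⟩
    refine notMem_range_of_adjoin_singleton_eq_top (by omega) hβ ⟨t + z / 3, ?_⟩
    rw [map_add, ht, sub_add_cancel]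
  · have : CharZero K := charZero_of_injective_algebraMap (algebraMap F K).injective
    simp only [map_sub, map_neg, map_mul, map_div₀, map_pow, map_ofNat]
    simp at hcube
    linear_combination -hcube

theorem exists_nat_eq_neg_three_mul_sq {D : ℤ} (hD : D ≠ 0) {s : ℚ} (h : (D : ℚ) = -3 * s ^ 2) :
    ∃ f : ℕ, 0 < f ∧ D = -3 * (f : ℤ) ^ 2 := by
  obtain ⟨t, ht⟩ : IsSquare (-3 * D) := by
    rw [← Rat.isSquare_intCast_iff]
    exact ⟨3 * s, by push_cast; rw [h]; ring⟩
  obtain ⟨u, rfl⟩ : 3 ∣ t := Int.prime_three.dvd_of_dvd_pow (n := 2) ⟨-D, by linarith⟩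
  have hu : D = -3 * u ^ 2 := by linarith
  refine ⟨u.natAbs, Int.natAbs_pos.mpr ?_, by rw [Int.natCast_natAbs, sq_abs, hu]⟩
  rintro rfl
  exact hD (by simpa using hu)

/-- If `-4 p ^ 3 - 27 r ^ 2 = -3 g ^ 2`, then a root `β` of `X ^ 3 + p * X + r` yields an explicit
pure cubic generator: the trace-zero element `β ^ 2 + c * β + 2 * p / 3`, with `c` chosen such that
its square has trace zero too. -/
theorem exists_pure_cubic_generator {F K : Type*} [Field F] [CharZero F] [Field K] [Algebra F K]
    (hdeg : Module.finrank F K = 3) {β : K} (hβ : IntermediateField.adjoin F {β} = ⊤) {p r g : F}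
    (h : β ^ 3 + algebraMap F K p * β + algebraMap F K r = 0)
    (hg : -4 * p ^ 3 - 27 * r ^ 2 = -3 * g ^ 2) :
    ∃ α : K, IntermediateField.adjoin F {α} = ⊤ ∧ ∃ q : F, α ^ 3 = algebraMap F K q := by
  have : FiniteDimensional F K := Module.finite_of_finrank_pos (by omega)
  have : CharZero K := charZero_of_injective_algebraMap (algebraMap F K).injective
  obtain rfl | hp := eq_or_ne p 0
  · refine ⟨β, hβ, -r, ?_⟩
    simp only [map_zero, map_neg] at h ⊢
    linear_combination h
  obtain ⟨c, hc⟩ : ∃ c : F, p * c ^ 2 + 3 * r * c - p ^ 2 / 3 = 0 := by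
    refine ⟨-(3 * r + g) / (2 * p), ?_⟩
    field_simp
    linear_combination hg
  refine ⟨β ^ 2 + algebraMap F K c * β + algebraMap F K (2 * p / 3),
    adjoin_singleton_eq_top_of_notMem_range (hdeg ▸ Nat.prime_three) ?_,
    8 * p ^ 3 / 27 - r * c ^ 3 - p * c * r + r ^ 2, ?_⟩
  · rintro ⟨t, ht⟩
    obtain ⟨b, hb⟩ := exists_basis_pow hdeg hβ
    have hrel : b 2 + c • b 1 + (2 * p / 3 - t) • b 0 = 0 := by
      simp only [hb, Algebra.smul_def, map_sub, ht]
      simp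
    simpa using congrArg (fun v => b.repr v 2) hrel
  · have hc' := congrArg (algebraMap F K) hc
    simp only [map_add, map_sub, map_mul, map_div₀, map_pow, map_ofNat, map_zero] at hc' ⊢
    linear_combination (β ^ 3 + 3 * algebraMap F K c * β ^ 2 +
      (3 * algebraMap F K c ^ 2 + algebraMap F K p) * β +
      (algebraMap F K c ^ 3 + algebraMap F K p * algebraMap F K c - algebraMap F K r)) * h -
      (β ^ 2 + algebraMap F K c * β) * hc'

/-- First part of Lemma 9.6: a cubic number field `K` is pure (i.e. generated by a
cube root of a rational number) if and only if its discriminant has the form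
`-3 f²` for some positive integer `f`. -/
theorem pure_cubic_iff_discr_eq_neg_three_mul_sq
    (K : Type*) [Field K] [NumberField K]
    (hdeg : Module.finrank ℚ K = 3) :
    (∃ α : K, IntermediateField.adjoin ℚ {α} = ⊤ ∧ ∃ q : ℚ, α ^ 3 = (q : K)) ↔
      ∃ f : ℕ, 0 < f ∧ NumberField.discr K = -3 * (f : ℤ) ^ 2 := by
  constructor
  · rintro ⟨α, hα, q, hq⟩
    obtain ⟨b, hb⟩ := exists_basis_pow hdeg hα
    obtain ⟨s, hs, hD⟩ := exists_discr_eq_sq_mul_numberField_discr b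
    rw [discr_powerBasis_depressed_cubic b α 0 (-q) hb (by simp [hq])] at hD
    refine exists_nat_eq_neg_three_mul_sq (NumberField.discr_ne_zero K) (s := 3 * q / s) ?_
    field_simp
    linear_combination -hD
  · rintro ⟨f, -, hf⟩
    obtain ⟨β, hβ, p, r, h⟩ := exists_depressed_cubic_generator hdeg
    obtain ⟨b, hb⟩ := exists_basis_pow hdeg hβ
    obtain ⟨s, -, hD⟩ := exists_discr_eq_sq_mul_numberField_discr b
    rw [discr_powerBasis_depressed_cubic b β p r hb h, hf] at hD
    push_cast at hD
    simpa using exists_pure_cubic_generator hdeg hβ (g := s * f) h (by rw [hD]; ring)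
end

section
/- Let a and b be coprime squarefree positive integers with ab ≥ 2, set m = a·b², and let K = ℚ(θ) where θ is the real cube root of m (so [K : ℚ] = 3). Then the discriminant of K equals −27·a²·b² if a² ≢ b² (mod 9), and equals −3·a²·b² if a² ≡ b² (mod 9). -/
/-- The norm form of the pure cubic order spanned by `1`, `∛(ab²)` and `∛(a²b)`. -/
def cubicNorm {R : Type*} [CommRing R] (a b x y z : R) : R :=
  x ^ 3 + a * b ^ 2 * y ^ 3 + a ^ 2 * b * z ^ 3 - 3 * a * b * x * y * z

lemma cubicNorm_swap {R : Type*} [CommRing R] (a b x y z : R) :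
    cubicNorm a b x y z = cubicNorm b a x z y := by
  unfold cubicNorm; ring

lemma prime_dvd_of_pow_dvd_cubicNorm {p a b x y z : ℤ} (hp : Prime p) (hpa : p ∣ a)
    (hpa2 : ¬ p ^ 2 ∣ a) (hpb : ¬ p ∣ b) (h : p ^ 3 ∣ cubicNorm a b x y z) :
    p ∣ x ∧ p ∣ y ∧ p ∣ z := by
  unfold cubicNorm at h
  obtain ⟨c, rfl⟩ := hpa
  have hp0 := hp.ne_zero
  have hc : ¬ p ∣ c := fun ⟨e, he⟩ => hpa2 ⟨e, by rw [he]; ring⟩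
  obtain ⟨n, hn⟩ := h
  have hx : p ∣ x := by
    apply hp.dvd_of_dvd_pow (n := 3)
    exact ⟨p ^ 2 * n - c * b ^ 2 * y ^ 3 - p * c ^ 2 * b * z ^ 3 + 3 * c * b * x * y * z, by
      linear_combination hn⟩
  obtain ⟨x, rfl⟩ := hx
  have hy : p ∣ y := by
    have h1 : p ∣ c * b ^ 2 * y ^ 3 :=
      ⟨p * n - p * x ^ 3 - c ^ 2 * b * z ^ 3 + 3 * c * b * x * y * z, by
        apply mul_left_cancel₀ hp0
        linear_combination hn⟩
    rcases hp.dvd_or_dvd h1 with h1 | h1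
    · rcases hp.dvd_or_dvd h1 with h1 | h1
      · exact absurd h1 hc
      · exact absurd (hp.dvd_of_dvd_pow h1) hpb
    · exact hp.dvd_of_dvd_pow h1
  obtain ⟨y, rfl⟩ := hy
  refine ⟨dvd_mul_right _ _, dvd_mul_right _ _, ?_⟩
  have h1 : p ∣ c ^ 2 * b * z ^ 3 :=
    ⟨n - x ^ 3 - p * c * b ^ 2 * y ^ 3 + 3 * c * b * x * y * z, by
      apply mul_left_cancel₀ (pow_ne_zero 2 hp0)
      linear_combination hn⟩
  rcases hp.dvd_or_dvd h1 with h1 | h1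
  · rcases hp.dvd_or_dvd h1 with h1 | h1
    · exact absurd (hp.dvd_of_dvd_pow h1) hc
    · exact absurd h1 hpb
  · exact hp.dvd_of_dvd_pow h1

lemma dvd_of_pow_dvd_cubicNorm {a b : ℕ} (hcop : a.Coprime b) (hsa : Squarefree a)
    (hsb : Squarefree b) (d : ℕ) (hd : d ≠ 0) (hdab : ∀ p : ℕ, p.Prime → p ∣ d → p ∣ a * b)
    {x y z : ℤ} (h : (d : ℤ) ^ 3 ∣ cubicNorm (a : ℤ) b x y z) :
    (d : ℤ) ∣ x ∧ (d : ℤ) ∣ y ∧ (d : ℤ) ∣ z := by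
  induction d using induction_on_primes generalizing x y z with
  | zero => exact absurd rfl hd
  | one => simp
  | prime_mul p d hp ih =>
    have hp' : Prime (p : ℤ) := Nat.prime_iff_prime_int.mp hp
    have hsq {c : ℕ} (hc : Squarefree c) : ¬ (p : ℤ) ^ 2 ∣ c := fun hpc => by
      have : p * p ∣ c := by rw [← pow_two]; exact_mod_cast hpc
      exact hp.one_lt.ne' (Nat.isUnit_iff.mp (hc p this))
    have hpN : (p : ℤ) ^ 3 ∣ cubicNorm (a : ℤ) b x y z :=
      (pow_dvd_pow_of_dvd ⟨(d : ℤ), by push_cast; ring⟩ 3).trans h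
    have hxyz : (p : ℤ) ∣ x ∧ (p : ℤ) ∣ y ∧ (p : ℤ) ∣ z := by
      rcases hp.dvd_mul.mp (hdab p hp (dvd_mul_right _ _)) with hpa | hpb
      · refine prime_dvd_of_pow_dvd_cubicNorm hp' (Int.natCast_dvd_natCast.mpr hpa) (hsq hsa) ?_ hpN
        rw [Int.natCast_dvd_natCast]
        exact fun hpb => hp.one_lt.ne' (Nat.eq_one_of_dvd_coprimes hcop hpa hpb)
      · rw [cubicNorm_swap] at hpN
        have := prime_dvd_of_pow_dvd_cubicNorm hp' (Int.natCast_dvd_natCast.mpr hpb) (hsq hsb) ?_ hpN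
        · tauto
        rw [Int.natCast_dvd_natCast]
        exact fun hpa => hp.one_lt.ne' (Nat.eq_one_of_dvd_coprimes hcop hpa hpb)
    obtain ⟨⟨x, rfl⟩, ⟨y, rfl⟩, ⟨z, rfl⟩⟩ := hxyz
    obtain ⟨n, hn⟩ := h
    have := ih (right_ne_zero_of_mul hd) (fun q hq hqd => hdab q hq (hqd.mul_left p))
      (x := x) (y := y) (z := z) ⟨n, by
        apply mul_left_cancel₀ (pow_ne_zero 3 hp'.ne_zero)
        unfold cubicNorm at hn ⊢
        push_cast at hn
        linear_combination hn⟩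
    push_cast
    exact ⟨mul_dvd_mul_left _ this.1, mul_dvd_mul_left _ this.2.1, mul_dvd_mul_left _ this.2.2⟩

lemma eq_zero_of_cubicNorm_eq_zero {a b : ℕ} (hcop : a.Coprime b) (hsa : Squarefree a)
    (hsb : Squarefree b) (hab : 2 ≤ a * b) {x y z : ℤ} (h : cubicNorm (a : ℤ) b x y z = 0) :
    x = 0 ∧ y = 0 ∧ z = 0 := by
  have key (k : ℕ) := dvd_of_pow_dvd_cubicNorm hcop hsa hsb ((a * b) ^ k)
    (pow_ne_zero _ (by omega)) (fun p hp hpd => hp.dvd_of_dvd_pow hpd) (h ▸ dvd_zero _)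
  have hlt (n : ℤ) (hn : (((a * b) ^ n.natAbs : ℕ) : ℤ) ∣ n) : n = 0 := by
    refine Int.eq_zero_of_abs_lt_dvd hn ?_
    rw [Int.abs_eq_natAbs]
    exact_mod_cast Nat.lt_pow_self hab
  exact ⟨hlt x (key _).1, hlt y (key _).2.1, hlt z (key _).2.2⟩

set_option synthInstance.maxHeartbeats 200000 in
set_option synthInstance.maxSize 1000 in
lemma three_dvd_sub_of_dvd_cubicNorm {a b x y z : ℤ} (ha : ¬ 3 ∣ a) (hb : ¬ 3 ∣ b)
    (hN : 27 ∣ cubicNorm a b x y z) (hT : 3 ∣ x ^ 2 + 2 * a * b * y * z) :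
    3 ∣ x - b * z ∧ 3 ∣ y - a * b * z := by
  have hN3 : (3 : ℤ) ∣ cubicNorm a b x y z := dvd_trans (by norm_num) hN
  have e (n : ℤ) : (3 ∣ n) ↔ ((n : ℤ) : ZMod 3) = 0 := (ZMod.intCast_zmod_eq_zero_iff_dvd n 3).symm
  unfold cubicNorm at hN3
  rw [e, e]
  rw [e] at ha hb hN3 hT
  push_cast at *
  generalize (a : ZMod 3) = a, (b : ZMod 3) = b, (x : ZMod 3) = x, (y : ZMod 3) = y,
    (z : ZMod 3) = z at *
  clear e hN
  revert a b x y z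
  decide

lemma three_dvd_sq_sub_one {a : ℤ} (ha : ¬ 3 ∣ a) : 3 ∣ a ^ 2 - 1 := by
  have e (n : ℤ) : (3 ∣ n) ↔ ((n : ℤ) : ZMod 3) = 0 := (ZMod.intCast_zmod_eq_zero_iff_dvd n 3).symm
  rw [e] at *
  push_cast at *
  generalize (a : ZMod 3) = a at *
  revert a
  decide

lemma nine_dvd_sq_sub_sq_of_dvd_cubicNorm {a b x y z : ℤ} (ha : ¬ 3 ∣ a) (hb : ¬ 3 ∣ b)
    (hz : ¬ 3 ∣ z) (hN : 27 ∣ cubicNorm a b x y z) (hT : 3 ∣ x ^ 2 + 2 * a * b * y * z) :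
    9 ∣ a ^ 2 - b ^ 2 := by
  obtain ⟨⟨u, hu⟩, ⟨v, hv⟩⟩ := three_dvd_sub_of_dvd_cubicNorm ha hb hN hT
  obtain ⟨i, hi⟩ := three_dvd_sq_sub_one ha
  obtain ⟨j, hj⟩ := three_dvd_sq_sub_one hb
  obtain rfl : x = b * z + 3 * u := by linarith
  obtain rfl : y = a * b * z + 3 * v := by linarith
  have h3 : Prime (3 : ℤ) := Int.prime_three
  have h1 : 27 ∣ z ^ 3 * b * (a ^ 2 + b ^ 2 + a ^ 4 * b ^ 4 - 3 * a ^ 2 * b ^ 2) := by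
    obtain ⟨n, hn⟩ := hN
    unfold cubicNorm at hn
    refine ⟨n + u * z ^ 2 * b ^ 2 * i - v * z ^ 2 * a * b ^ 2 * (i * b ^ 2 + j)
      - (b * z * u ^ 2 + u ^ 3 + a ^ 2 * b ^ 3 * z * v ^ 2 + a * b ^ 2 * v ^ 3)
      + a * b * u * v * z, ?_⟩
    linear_combination hn + 9 * b ^ 2 * z ^ 2 * u * hi
      - 9 * a * b ^ 2 * z ^ 2 * v * (b ^ 2 * hi + hj)
  have h2 : a ^ 2 + b ^ 2 + a ^ 4 * b ^ 4 - 3 * a ^ 2 * b ^ 2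
      = 9 * (i ^ 2 + i * j + j ^ 2) + 27 * (2 * i * j * (i + j) + 3 * i ^ 2 * j ^ 2) := by
    have hA : a ^ 2 = 1 + 3 * i := by linarith
    have hB : b ^ 2 = 1 + 3 * j := by linarith
    have : a ^ 2 + b ^ 2 + a ^ 4 * b ^ 4 - 3 * a ^ 2 * b ^ 2
      = a ^ 2 + b ^ 2 + (a ^ 2) ^ 2 * (b ^ 2) ^ 2 - 3 * (a ^ 2 * b ^ 2) := by ring
    rw [this, hA, hB]
    ring
  have h4 : 3 ∣ z ^ 3 * b * (i - j) ^ 2 := by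
    obtain ⟨n, hn⟩ := h1
    rw [h2] at hn
    exact ⟨n - z ^ 3 * b * (2 * i * j * (i + j) + 3 * i ^ 2 * j ^ 2 + i * j), by linarith⟩
  obtain ⟨k, hk⟩ : 3 ∣ i - j := by
    rcases h3.dvd_or_dvd h4 with h4 | h4
    · rcases h3.dvd_or_dvd h4 with h4 | h4
      · exact absurd (h3.dvd_of_dvd_pow h4) hz
      · exact absurd h4 hb
    · exact h3.dvd_of_dvd_pow h4
  exact ⟨k, by linarith⟩

lemma dvd_cubicNorm_of_nine_dvd {a b : ℤ} (hb : ¬ 3 ∣ b) (h : 9 ∣ a ^ 2 - b ^ 2) :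
    27 ∣ cubicNorm a b 1 a b := by
  obtain ⟨k, hk⟩ := h
  obtain ⟨j, hj⟩ := three_dvd_sq_sub_one hb
  have hA : a ^ 2 = 1 + 3 * (j + 3 * k) := by linarith
  have hB : b ^ 2 = 1 + 3 * j := by linarith
  have : cubicNorm a b 1 a b = 1 + a ^ 2 * b ^ 2 * (a ^ 2 + b ^ 2 - 3) := by unfold cubicNorm; ring
  rw [this, hA, hB]
  exact ⟨j ^ 2 + 3 * j * k + 3 * k ^ 2 + (j + 3 * k) * j * (2 * j + 3 * k), by ring⟩

section NumberField

open Module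

open scoped NumberField

lemma NumberField.discr_eq_of_basis {K : Type*} [Field K] [NumberField K] {ι : Type*} [Fintype ι]
    [DecidableEq ι] (B : Basis ι ℚ K) (hB : ∀ i, IsIntegral ℤ (B i))
    (hint : ∀ x : K, IsIntegral ℤ x → ∀ i, IsIntegral ℤ (B.repr x i)) :
    (NumberField.discr K : ℚ) = Algebra.discr ℚ B := by
  classical
  rw [NumberField.coe_discr]
  refine Algebra.discr_eq_discr_of_toMatrix_coeff_isIntegral K (fun i j => ?_) fun i j => ?_
  · obtain ⟨y, hy⟩ : ∃ y : 𝓞 K, algebraMap (𝓞 K) K y = B j := ⟨⟨B j, hB j⟩, rfl⟩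
    rw [Basis.toMatrix_apply, ← hy, NumberField.integralBasis_repr_apply]
    exact isIntegral_algebraMap
  · rw [Basis.toMatrix_apply, NumberField.integralBasis_apply]
    exact hint _ (NumberField.RingOfIntegers.isIntegral_coe _) i

variable {K : Type*} [Field K] {a b : ℕ} {α β : K}

lemma cubicNorm_eq_mul {R : Type*} [CommRing R] {a b α β : R} (h1 : α * α = b * β)
    (h2 : β * β = a * α) (h3 : α * β = a * b) (x y z : R) :
    cubicNorm a b x y z = (x + y * α + z * β) *
      (x ^ 2 - a * b * y * z + (a * z ^ 2 - x * y) * α + (b * y ^ 2 - x * z) * β) := by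
  unfold cubicNorm
  linear_combination (-(y * (a * z ^ 2 - x * y))) * h1 - z * (b * y ^ 2 - x * z) * h2
    - (y * (b * y ^ 2 - x * z) + z * (a * z ^ 2 - x * y)) * h3

lemma linearIndependent_one_cubeRoots [CharZero K] (hcop : a.Coprime b) (hsa : Squarefree a)
    (hsb : Squarefree b) (hab : 2 ≤ a * b) (h1 : α * α = b * β) (h2 : β * β = a * α)
    (h3 : α * β = a * b) : LinearIndependent ℚ ![1, α, β] := by
  rw [← LinearIndependent.iff_fractionRing (R := ℤ), Fintype.linearIndependent_iff]
  intro g hg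
  simp only [Fin.sum_univ_three, zsmul_eq_mul, Matrix.cons_val, mul_one] at hg
  have h0 := cubicNorm_eq_mul h1 h2 h3 (g 0 : K) (g 1) (g 2)
  rw [hg, zero_mul] at h0
  obtain ⟨e0, e1, e2⟩ := eq_zero_of_cubicNorm_eq_zero hcop hsa hsb hab
    (x := g 0) (y := g 1) (z := g 2) (by unfold cubicNorm at *; exact_mod_cast h0)
  intro i
  fin_cases i <;> assumption

lemma isIntegral_cubeRoots (h1 : α * α = b * β) (h2 : β * β = a * α) (h3 : α * β = a * b) :
    IsIntegral ℤ α ∧ IsIntegral ℤ β := by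
  have hn (n : ℕ) : IsIntegral ℤ (n : K) := by
    simpa using isIntegral_algebraMap (R := ℤ) (A := K) (x := n)
  constructor
  · refine IsIntegral.of_pow (n := 3) (by norm_num) ?_
    have : α ^ 3 = b * (a * b) := by linear_combination α * h1 + b * h3
    rw [this]
    exact (hn b).mul ((hn a).mul (hn b))
  · refine IsIntegral.of_pow (n := 3) (by norm_num) ?_
    have : β ^ 3 = a * (a * b) := by linear_combination β * h2 + a * h3
    rw [this]
    exact (hn a).mul ((hn a).mul (hn b))

variable [NumberField K] {B : Basis (Fin 3) ℚ K}

lemma repr_add_add (hB : ⇑B = ![1, α, β]) (x y z : ℚ) :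
    ⇑(B.repr (x + y * α + z * β)) = ![x, y, z] := by
  have : (x + y * α + z * β : K) = ∑ i, (![x, y, z] : Fin 3 → ℚ) i • B i := by
    simp [Fin.sum_univ_three, hB, Rat.smul_def]
  rw [this, B.repr_sum_self]

lemma exists_eq_add_add (hB : ⇑B = ![1, α, β]) (ξ : K) :
    ∃ x y z : ℚ, ξ = x + y * α + z * β :=
  ⟨B.repr ξ 0, B.repr ξ 1, B.repr ξ 2, by
    conv_lhs => rw [← B.sum_repr ξ]
    simp [Fin.sum_univ_three, hB, Rat.smul_def]⟩

lemma leftMulMatrix_add_add (hB : ⇑B = ![1, α, β]) (h1 : α * α = b * β)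
    (h2 : β * β = a * α) (h3 : α * β = a * b) (x y z : ℚ) :
    Algebra.leftMulMatrix B (x + y * α + z * β) =
      !![x, a * b * z, a * b * y; y, x, a * z; z, b * y, x] := by
  have e0 := repr_add_add hB x y z
  have e1 := repr_add_add hB (a * b * z) x (b * y)
  have e2 := repr_add_add hB (a * b * y) (a * z) x
  have m1 : (x + y * α + z * β : K) * α =
      ((a * b * z : ℚ) : K) + (x : ℚ) * α + ((b * y : ℚ) : K) * β := by
    push_cast; linear_combination (y : K) * h1 + (z : K) * h3
  have m2 : (x + y * α + z * β : K) * β =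
      ((a * b * y : ℚ) : K) + ((a * z : ℚ) : K) * α + (x : ℚ) * β := by
    push_cast; linear_combination (z : K) * h2 + (y : K) * h3
  ext i j
  rw [Algebra.leftMulMatrix_eq_repr_mul, hB]
  fin_cases j
  · simp only [Fin.zero_eta, Matrix.cons_val, mul_one, e0]
    fin_cases i <;> rfl
  · simp only [Fin.mk_one, Matrix.cons_val, m1, e1]
    fin_cases i <;> rfl
  · simp only [Fin.reduceFinMk, Matrix.cons_val, m2, e2]
    fin_cases i <;> rfl

lemma trace_add_add (hB : ⇑B = ![1, α, β]) (h1 : α * α = b * β)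
    (h2 : β * β = a * α) (h3 : α * β = a * b) (x y z : ℚ) :
    Algebra.trace ℚ K (x + y * α + z * β) = 3 * x := by
  rw [Algebra.trace_eq_matrix_trace B, leftMulMatrix_add_add hB h1 h2 h3]
  simp [Matrix.trace, Fin.sum_univ_three]
  ring

lemma norm_add_add (hB : ⇑B = ![1, α, β]) (h1 : α * α = b * β)
    (h2 : β * β = a * α) (h3 : α * β = a * b) (x y z : ℚ) :
    Algebra.norm ℚ (x + y * α + z * β : K) = cubicNorm (a : ℚ) b x y z := by
  rw [Algebra.norm_eq_matrix_det B, leftMulMatrix_add_add hB h1 h2 h3]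
  simp [Matrix.det_fin_three, cubicNorm]
  ring

lemma trace_mul_add_add (hB : ⇑B = ![1, α, β]) (h1 : α * α = b * β)
    (h2 : β * β = a * α) (h3 : α * β = a * b) (x y z x' y' z' : ℚ) :
    Algebra.trace ℚ K ((x + y * α + z * β) * (x' + y' * α + z' * β)) =
      3 * (x * x' + a * b * (y * z' + z * y')) := by
  rw [← trace_add_add hB h1 h2 h3 _ (x * y' + y * x' + a * z * z') (x * z' + z * x' + b * y * y')]
  congr 1
  push_cast
  linear_combination (y * y' : K) * h1 + (z * z' : K) * h2 + (y * z' + z * y' : K) * h3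

lemma exists_int_of_isIntegral {q : ℚ} (h : IsIntegral ℤ q) : ∃ n : ℤ, (n : ℚ) = q := by
  obtain ⟨n, hn⟩ := IsIntegrallyClosed.isIntegral_iff.1 h
  exact ⟨n, by simpa using hn⟩

lemma isIntegral_int_cast_rat (n : ℤ) : IsIntegral ℤ (n : ℚ) := isIntegral_algebraMap (x := n)

/-- Integrality of `x + yα + zβ` forces `3x`, `3y`, `3z` to be integers,
divisible by `3` if moreover `3 ∣ ab`. -/
lemma exists_three_mul_eq (hcop : a.Coprime b) (hsa : Squarefree a) (hsb : Squarefree b)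
    (hab : a * b ≠ 0) (hB : ⇑B = ![1, α, β]) (h1 : α * α = b * β)
    (h2 : β * β = a * α) (h3 : α * β = a * b) {x y z : ℚ}
    (hint : IsIntegral ℤ (x + y * α + z * β : K)) (d : ℕ) (hd : d = 1 ∨ d = 3)
    (hd3 : d = 3 → 3 ∣ a * b) :
    ∃ X Y Z : ℤ, X * d = 3 * x ∧ Y * d = 3 * y ∧ Z * d = 3 * z := by
  obtain ⟨hα, hβ⟩ := isIntegral_cubeRoots h1 h2 h3
  have t0 := trace_add_add hB h1 h2 h3 x y z
  have t1 := trace_mul_add_add hB h1 h2 h3 x y z 0 1 0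
  have t2 := trace_mul_add_add hB h1 h2 h3 x y z 0 0 1
  simp only [Rat.cast_zero, Rat.cast_one, zero_mul, one_mul, zero_add, add_zero, mul_zero,
    mul_one] at t1 t2
  obtain ⟨X, hX⟩ := exists_int_of_isIntegral (Algebra.isIntegral_trace (L := ℚ) hint)
  obtain ⟨Z, hZ⟩ := exists_int_of_isIntegral (Algebra.isIntegral_trace (L := ℚ) (hint.mul hα))
  obtain ⟨Y, hY⟩ := exists_int_of_isIntegral (Algebra.isIntegral_trace (L := ℚ) (hint.mul hβ))
  obtain ⟨n, hn⟩ := exists_int_of_isIntegral (Algebra.isIntegral_norm ℚ hint)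
  rw [norm_add_add hB h1 h2 h3] at hn
  rw [t0] at hX
  rw [t1] at hZ
  rw [t2] at hY
  have hd0 : d ≠ 0 := by omega
  have hab' : (a * b : ℚ) ≠ 0 := by exact_mod_cast hab
  obtain ⟨e, he⟩ : d ∣ 3 := by rcases hd with rfl | rfl <;> norm_num
  have he' : (d * e : ℚ) = 3 := by exact_mod_cast he.symm
  obtain ⟨⟨X', hX'⟩, ⟨Y', hY'⟩, ⟨Z', hZ'⟩⟩ := dvd_of_pow_dvd_cubicNorm hcop hsa hsb (d * (a * b))
    (mul_ne_zero hd0 hab)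
    (fun p hp hpd => by
      rcases hp.dvd_mul.mp hpd with h | h
      · rcases hd with rfl | rfl
        · exact absurd (Nat.dvd_one.mp h) hp.one_lt.ne'
        · rw [(Nat.prime_dvd_prime_iff_eq hp Nat.prime_three).mp h]
          exact hd3 rfl
      · exact h)
    (x := X * (a * b)) (y := Y) (z := Z) ⟨e ^ 3 * n, by
      have : cubicNorm (a : ℚ) b (X * (a * b)) Y Z = (d * (a * b)) ^ 3 * (e ^ 3 * n) := by
        have : ((d : ℚ) * (a * b)) ^ 3 * (e ^ 3 * n) = (d * e) ^ 3 * (a * b) ^ 3 * n := by ring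
        rw [this, he', hX, hY, hZ, hn]
        unfold cubicNorm
        ring
      unfold cubicNorm at *
      exact_mod_cast this⟩
  refine ⟨X', Y', Z', ?_, ?_, ?_⟩ <;> apply mul_left_cancel₀ hab'
  · have : (X * (a * b) : ℚ) = d * (a * b) * X' := by exact_mod_cast hX'
    rw [hX] at this
    linear_combination -this
  · have : (Y : ℚ) = d * (a * b) * Y' := by exact_mod_cast hY'
    rw [hY] at this
    linear_combination -this
  · have : (Z : ℚ) = d * (a * b) * Z' := by exact_mod_cast hZ'
    rw [hZ] at this
    linear_combination -this

lemma exists_int_of_three_dvd (hcop : a.Coprime b) (hsa : Squarefree a) (hsb : Squarefree b)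
    (hab : a * b ≠ 0) (h : 3 ∣ a * b) (hB : ⇑B = ![1, α, β]) (h1 : α * α = b * β)
    (h2 : β * β = a * α) (h3 : α * β = a * b) {x y z : ℚ}
    (hint : IsIntegral ℤ (x + y * α + z * β : K)) :
    ∃ X Y Z : ℤ, X = x ∧ Y = y ∧ Z = z := by
  obtain ⟨X, Y, Z, hX, hY, hZ⟩ :=
    exists_three_mul_eq hcop hsa hsb hab hB h1 h2 h3 hint 3 (.inr rfl) fun _ => h
  push_cast at hX hY hZ
  exact ⟨X, Y, Z, by linarith, by linarith, by linarith⟩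

lemma exists_int_of_not_three_dvd (hcop : a.Coprime b) (hsa : Squarefree a) (hsb : Squarefree b)
    (hab : a * b ≠ 0) (hB : ⇑B = ![1, α, β]) (h1 : α * α = b * β)
    (h2 : β * β = a * α) (h3 : α * β = a * b) {x y z : ℚ}
    (hint : IsIntegral ℤ (x + y * α + z * β : K)) :
    ∃ X Y Z : ℤ, X = 3 * x ∧ Y = 3 * y ∧ Z = 3 * z ∧ 27 ∣ cubicNorm (a : ℤ) b X Y Z ∧
      3 ∣ X ^ 2 + 2 * a * b * Y * Z := by
  obtain ⟨X, Y, Z, hX, hY, hZ⟩ :=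
    exists_three_mul_eq hcop hsa hsb hab hB h1 h2 h3 hint 1 (.inl rfl) (by norm_num)
  rw [Nat.cast_one, mul_one] at hX hY hZ
  refine ⟨X, Y, Z, hX, hY, hZ, ?_, ?_⟩
  · obtain ⟨n, hn⟩ := exists_int_of_isIntegral (Algebra.isIntegral_norm ℚ hint)
    rw [norm_add_add hB h1 h2 h3] at hn
    refine ⟨n, ?_⟩
    have : cubicNorm (a : ℚ) b X Y Z = 27 * n := by
      rw [hn, hX, hY, hZ]; unfold cubicNorm; ring
    unfold cubicNorm at *
    exact_mod_cast this
  · obtain ⟨n, hn⟩ := exists_int_of_isIntegral (Algebra.isIntegral_trace (L := ℚ) (hint.mul hint))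
    rw [trace_mul_add_add hB h1 h2 h3] at hn
    refine ⟨n, ?_⟩
    have : (X ^ 2 + 2 * a * b * Y * Z : ℚ) = 3 * n := by
      rw [hn, hX, hY, hZ]; ring
    exact_mod_cast this

lemma discr_cubic_of_not_modEq (hcop : a.Coprime b) (hsa : Squarefree a) (hsb : Squarefree b)
    (hab : a * b ≠ 0) (hB : ⇑B = ![1, α, β]) (h1 : α * α = b * β)
    (h2 : β * β = a * α) (h3 : α * β = a * b) (h9 : ¬ (9 : ℤ) ∣ a ^ 2 - b ^ 2) :
    NumberField.discr K = -27 * (a : ℤ) ^ 2 * (b : ℤ) ^ 2 := by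
  obtain ⟨hα, hβ⟩ := isIntegral_cubeRoots h1 h2 h3
  have hBi : ∀ i, IsIntegral ℤ (B i) := by
    rw [hB]
    intro i
    fin_cases i
    exacts [isIntegral_one, hα, hβ]
  have key := NumberField.discr_eq_of_basis B hBi fun ξ hξ => by
    obtain ⟨x, y, z, rfl⟩ := exists_eq_add_add hB ξ
    obtain ⟨X, Y, Z, rfl, rfl, rfl⟩ : ∃ X Y Z : ℤ, (X : ℚ) = x ∧ (Y : ℚ) = y ∧ (Z : ℚ) = z := by
      by_cases h : 3 ∣ a * b
      · exact exists_int_of_three_dvd hcop hsa hsb hab h hB h1 h2 h3 hξ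
      have ha : ¬ (3 : ℤ) ∣ a := fun h' =>
        h ((Int.natCast_dvd_natCast.mp h').mul_right b)
      have hb : ¬ (3 : ℤ) ∣ b := fun h' =>
        h ((Int.natCast_dvd_natCast.mp h').mul_left a)
      obtain ⟨X, Y, Z, hX, hY, hZ, hN, hT⟩ :=
        exists_int_of_not_three_dvd hcop hsa hsb hab hB h1 h2 h3 hξ
      have hZ3 : 3 ∣ Z := by
        by_contra hZ3
        exact h9 (nine_dvd_sq_sub_sq_of_dvd_cubicNorm ha hb hZ3 hN hT)
      obtain ⟨hX3, hY3⟩ := three_dvd_sub_of_dvd_cubicNorm ha hb hN hT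
      obtain ⟨X, rfl⟩ := (dvd_sub_left (hZ3.mul_left _)).mp hX3
      obtain ⟨Y, rfl⟩ := (dvd_sub_left (hZ3.mul_left _)).mp hY3
      obtain ⟨Z, rfl⟩ := hZ3
      push_cast at hX hY hZ
      exact ⟨X, Y, Z, by linarith, by linarith, by linarith⟩
    rw [repr_add_add hB]
    intro i
    fin_cases i <;> exact isIntegral_int_cast_rat _
  have hd : Algebra.discr ℚ B = -27 * (a : ℚ) ^ 2 * (b : ℚ) ^ 2 := by
    have t := trace_mul_add_add hB h1 h2 h3
    have t00 := t 1 0 0 1 0 0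
    have t01 := t 1 0 0 0 1 0
    have t02 := t 1 0 0 0 0 1
    have t11 := t 0 1 0 0 1 0
    have t12 := t 0 1 0 0 0 1
    have t21 := t 0 0 1 0 1 0
    have t22 := t 0 0 1 0 0 1
    simp only [Rat.cast_zero, Rat.cast_one, zero_mul, one_mul, zero_add, add_zero, mul_zero,
      mul_one] at t00 t01 t02 t11 t12 t21 t22
    rw [Algebra.discr_def, Matrix.det_fin_three]
    simp only [Algebra.traceMatrix_apply, Algebra.traceForm_apply, hB, Matrix.cons_val, one_mul,
      mul_one, t00, t01, t02, t11, t12, t21, t22]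
    ring
  rw [hd] at key
  exact_mod_cast key

lemma discr_cubic_of_modEq (hcop : a.Coprime b) (hsa : Squarefree a) (hsb : Squarefree b)
    (hab : a * b ≠ 0) (hB : ⇑B = ![1, α, β]) (h1 : α * α = b * β)
    (h2 : β * β = a * α) (h3 : α * β = a * b) (h9 : (9 : ℤ) ∣ a ^ 2 - b ^ 2) :
    NumberField.discr K = -3 * (a : ℤ) ^ 2 * (b : ℤ) ^ 2 := by
  obtain ⟨hα, hβ⟩ := isIntegral_cubeRoots h1 h2 h3
  have h39 : (3 : ℤ) ∣ a ^ 2 - b ^ 2 := dvd_trans (by norm_num) h9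
  have h3iff : (3 : ℤ) ∣ a ↔ (3 : ℤ) ∣ b := by
    have := dvd_iff_dvd_of_dvd_sub h39
    rwa [Int.prime_three.dvd_pow_iff_dvd two_ne_zero,
      Int.prime_three.dvd_pow_iff_dvd two_ne_zero] at this
  have hb : ¬ (3 : ℤ) ∣ b := fun hb => by
    have ha := h3iff.mpr hb
    have := Nat.dvd_gcd (Int.natCast_dvd_natCast.mp ha) (Int.natCast_dvd_natCast.mp hb)
    rw [hcop.gcd_eq_one] at this
    exact absurd this (by norm_num)
  have ha : ¬ (3 : ℤ) ∣ a := h3iff.not.mpr hb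
  set η : K := ((1 / 3 : ℚ) : K) + ((a / 3 : ℚ) : K) * α + ((b / 3 : ℚ) : K) * β with hη
  have hηi : IsIntegral ℤ η := by
    obtain ⟨n, hn⟩ := dvd_cubicNorm_of_nine_dvd hb h9
    obtain ⟨i, hi⟩ := three_dvd_sq_sub_one ha
    obtain ⟨j, hj⟩ := three_dvd_sq_sub_one hb
    have hi' : (a : K) ^ 2 - 1 = 3 * i := by exact_mod_cast congrArg (Int.cast : ℤ → K) hi
    have hj' : (b : K) ^ 2 - 1 = 3 * j := by exact_mod_cast congrArg (Int.cast : ℤ → K) hj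
    have hn' : cubicNorm (a : K) b 1 a b = 27 * n := by
      have := congrArg (Int.cast : ℤ → K) hn
      unfold cubicNorm at *
      exact_mod_cast this
    refine ⟨Polynomial.X ^ 3 - Polynomial.X ^ 2 - Polynomial.C (i * b ^ 2 + j) * Polynomial.X
      - Polynomial.C n, ?_, ?_⟩
    · monicity!
    · have hw : (a * α + b * β) ^ 3 =
          3 * (a * b) ^ 2 * (a * α + b * β) + a ^ 4 * b ^ 2 + a ^ 2 * b ^ 4 := by
        linear_combination (a ^ 3 * α : K) * h1 + (b ^ 3 * β : K) * h2
          + (3 * a * b * (a * α + b * β) + a ^ 3 * b + a * b ^ 3 : K) * h3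
      have hηw : η = (1 + (a * α + b * β)) / 3 := by
        rw [hη]; push_cast; ring
      unfold cubicNorm at hn'
      rw [hηw]
      generalize (a * α + b * β : K) = w at hw
      simp only [Polynomial.eval₂_sub, Polynomial.eval₂_mul, Polynomial.eval₂_pow,
        Polynomial.eval₂_X, Polynomial.eval₂_C]
      simp only [eq_intCast]
      push_cast
      linear_combination (hw + hn' + 3 * (1 + w) * (b ^ 2 * hi' + hj')) / 27
  have hd : Algebra.discr ℚ ![η, α, β] = -3 * (a : ℚ) ^ 2 * (b : ℚ) ^ 2 := by
    have t := trace_mul_add_add hB h1 h2 h3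
    have t00 := t (1 / 3) (a / 3) (b / 3) (1 / 3) (a / 3) (b / 3)
    have t01 := t (1 / 3) (a / 3) (b / 3) 0 1 0
    have t02 := t (1 / 3) (a / 3) (b / 3) 0 0 1
    have t11 := t 0 1 0 0 1 0
    have t12 := t 0 1 0 0 0 1
    have t22 := t 0 0 1 0 0 1
    simp only [← hη] at t00 t01 t02
    simp only [Rat.cast_zero, Rat.cast_one, zero_mul, one_mul, zero_add, add_zero, mul_zero,
      mul_one] at t00 t01 t02 t11 t12 t22
    rw [Algebra.discr_def, Matrix.det_fin_three]
    simp only [Algebra.traceMatrix_apply, Algebra.traceForm_apply, Matrix.cons_val, mul_comm α η,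
      mul_comm β η, mul_comm β α, t00, t01, t02, t11, t12, t22]
    ring
  have hli : LinearIndependent ℚ ![η, α, β] := by
    by_contra h
    have h0 := Algebra.discr_zero_of_not_linearIndependent ℚ h
    rw [hd] at h0
    have : (a * b : ℚ) ≠ 0 := by exact_mod_cast hab
    have : (a * b : ℚ) ^ 2 = 0 := by linear_combination -h0 / 3
    simp_all
  let C := basisOfLinearIndependentOfCardEqFinrank hli (finrank_eq_card_basis B).symm
  have hC : ⇑C = ![η, α, β] := coe_basisOfLinearIndependentOfCardEqFinrank _ _
  have hCi : ∀ i, IsIntegral ℤ (C i) := by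
    rw [hC]
    intro i
    fin_cases i
    exacts [hηi, hα, hβ]
  have key := NumberField.discr_eq_of_basis C hCi fun ξ hξ => by
    obtain ⟨x, y, z, rfl⟩ := exists_eq_add_add hB ξ
    obtain ⟨X, Y, Z, hX, hY, hZ, hN, hT⟩ :=
      exists_int_of_not_three_dvd hcop hsa hsb hab hB h1 h2 h3 hξ
    obtain ⟨⟨u, hu⟩, ⟨v, hv⟩⟩ := three_dvd_sub_of_dvd_cubicNorm ha hb hN hT
    obtain ⟨j, hj⟩ := three_dvd_sq_sub_one hb
    have hu' : (X - b * Z : ℚ) = 3 * u := by exact_mod_cast hu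
    have hv' : (Y - a * b * Z : ℚ) = 3 * v := by exact_mod_cast hv
    have hj' : (b ^ 2 - 1 : ℚ) = 3 * j := by exact_mod_cast hj
    have hy : y - a * x = ((v - a * u : ℤ) : ℚ) := by
      push_cast
      linear_combination (hv' + hX * a - hY - a * hu') / 3
    have hz : z - b * x = ((- j * Z - b * u : ℤ) : ℚ) := by
      push_cast
      linear_combination (hX * b - hZ - b * hu' - Z * hj') / 3
    have hsum : (x + y * α + z * β : K) =
        ∑ i, (![(X : ℚ), ((v - a * u : ℤ) : ℚ), ((- j * Z - b * u : ℤ) : ℚ)] : Fin 3 → ℚ) i • C i := by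
      rw [← hy, ← hz, hX]
      simp only [Fin.sum_univ_three, hC, Rat.smul_def, Matrix.cons_val, hη]
      push_cast
      ring
    rw [hsum, C.repr_sum_self]
    intro i
    fin_cases i <;> exact isIntegral_int_cast_rat _
  rw [hC, hd] at key
  exact_mod_cast key

end NumberField

/-- Discriminant of a pure cubic field (Lemma 9.6): for coprime squarefree positive
integers `a`, `b` with `a * b ≥ 2` and `θ ∈ ℝ` the real cube root of `m = a·b²`,
the cubic field `K = ℚ(θ)` has discriminant `-27a²b²` if `a² ≢ b² (mod 9)` and
`-3a²b²` if `a² ≡ b² (mod 9)`. -/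
theorem discr_pure_cubic_field
    (a b : ℕ) (ha : 0 < a) (hb : 0 < b) (hcop : Nat.Coprime a b)
    (hsa : Squarefree a) (hsb : Squarefree b) (hab : 2 ≤ a * b)
    (θ : ℝ) (hθ : θ ^ 3 = (a * b ^ 2 : ℕ))
    (K : IntermediateField ℚ ℝ) (hK : K = IntermediateField.adjoin ℚ {θ})
    [NumberField K] :
    (¬ a ^ 2 ≡ b ^ 2 [MOD 9] → NumberField.discr K = -27 * (a : ℤ) ^ 2 * (b : ℤ) ^ 2) ∧
    (a ^ 2 ≡ b ^ 2 [MOD 9] → NumberField.discr K = -3 * (a : ℤ) ^ 2 * (b : ℤ) ^ 2) := by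
  have hθK : θ ∈ K := hK ▸ IntermediateField.mem_adjoin_simple_self ℚ θ
  let α : K := ⟨θ, hθK⟩
  let β : K := α ^ 2 / b
  have hbK : (b : K) ≠ 0 := by exact_mod_cast hb.ne'
  have hα : α ^ 3 = a * b ^ 2 := by
    apply Subtype.ext
    simpa [α] using hθ
  have h1 : α * α = b * β := by simp only [β]; field_simp
  have h3 : α * β = a * b := by
    simp only [β]; field_simp; linear_combination hα
  have h2 : β * β = a * α := by
    simp only [β]; field_simp; linear_combination α * hα
  have hli := linearIndependent_one_cubeRoots hcop hsa hsb hab h1 h2 h3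
  have hrank : Fintype.card (Fin 3) = Module.finrank ℚ K := by
    apply le_antisymm hli.fintype_card_le_finrank
    have hp : (Polynomial.X ^ 3 - Polynomial.C ((a * b ^ 2 : ℕ) : ℚ)).Monic := by monicity!
    have he : Polynomial.aeval θ (Polynomial.X ^ 3 - Polynomial.C ((a * b ^ 2 : ℕ) : ℚ)) = 0 := by
      simp [hθ]
    rw [hK, IntermediateField.adjoin.finrank ⟨_, hp, he⟩]
    refine (Polynomial.natDegree_le_of_dvd (minpoly.dvd ℚ θ he) hp.ne_zero).trans ?_
    rw [Polynomial.natDegree_X_pow_sub_C, Fintype.card_fin]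
  have hB := coe_basisOfLinearIndependentOfCardEqFinrank hli hrank
  have hab0 : a * b ≠ 0 := by omega
  have h9 : a ^ 2 ≡ b ^ 2 [MOD 9] ↔ (9 : ℤ) ∣ a ^ 2 - b ^ 2 := by
    rw [Nat.ModEq.comm, Nat.modEq_iff_dvd]
    push_cast
    rfl
  rw [h9]
  exact ⟨discr_cubic_of_not_modEq hcop hsa hsb hab0 hB h1 h2 h3,
    discr_cubic_of_modEq hcop hsa hsb hab0 hB h1 h2 h3⟩
end
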